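/- Let Γ = (ℤ/3ℤ) × ℤ with generating set S = {(1,0),(2,0),(0,1),(0,-1)}. Then the Borel chromatic number of the shift graph of (Γ,S) equals 3. -/

import Mathlib

open Multiplicative

section Defs

variable {G : Type*} [Group G]

/-- The left shift action of `g : G` on `x : G → Bool` (`2^G` with `2 = Bool`):
`(g · x)(h) = x (g⁻¹ h)`. -/
def shiftMap (g : G) (x : G → Bool) : G → Bool := fun h => x (g⁻¹ * h)

/-- The free part `F(2^G)` of the left shift action. -/
def FreePart (G : Type*) [Group G] : Set (G → Bool) :=
  {x | ∀ g : G, g ≠ 1 → shiftMap g x ≠ x}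

/-- Adjacency in the shift graph of the marked group `(G, S)`: distinct `x, y ∈ F(2^G)`
are adjacent iff `y = s · x` for some `s ∈ S`. -/
def ShiftAdj (S : Set G) (x y : FreePart G) : Prop :=
  x ≠ y ∧ ∃ s ∈ S, (y : G → Bool) = shiftMap s (x : G → Bool)

/-- Adjacency in the Cayley graph of `(G, S)`: distinct `g, h` are adjacent iff
`h = s * g` for some `s ∈ S`. -/
def CayleyAdj (S : Set G) (g h : G) : Prop :=
  g ≠ h ∧ ∃ s ∈ S, h = s * g

/-- `(G, S)` is a marked group: `S` is a finite symmetric generating set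
not containing the identity. -/
def IsMarkedGroup (S : Set G) : Prop :=
  S.Finite ∧ (∀ s ∈ S, s⁻¹ ∈ S) ∧ (1 : G) ∉ S ∧ Subgroup.closure S = ⊤

end Defs

/-- A graph (given by its adjacency relation) has an `n`-coloring. -/
def HasColoring {X : Type*} (Adj : X → X → Prop) (n : ℕ) : Prop :=
  ∃ c : X → Fin n, ∀ x y, Adj x y → c x ≠ c y

/-- The chromatic number: the least `n` admitting an `n`-coloring. -/
noncomputable def chromatic {X : Type*} (Adj : X → X → Prop) : ℕ :=
  sInf {n | HasColoring Adj n}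

/-- A graph on a measurable space has a Borel `n`-coloring. -/
def HasBorelColoring {X : Type*} [MeasurableSpace X] (Adj : X → X → Prop) (n : ℕ) : Prop :=
  ∃ c : X → Fin n, Measurable c ∧ ∀ x y, Adj x y → c x ≠ c y

/-- The Borel chromatic number: the least `n` admitting a Borel `n`-coloring. -/
noncomputable def borelChromatic {X : Type*} [MeasurableSpace X] (Adj : X → X → Prop) : ℕ :=
  sInf {n | HasBorelColoring Adj n}
/-- The marked group `Γ = ℤ/3ℤ × ℤ` (written multiplicatively). -/
abbrev Gamma3 : Type := Multiplicative (ZMod 3 × ℤ)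

/-- The generating set `S = {(1,0), (2,0), (0,1), (0,-1)}` of `Γ`. -/
def S3 : Set Gamma3 :=
  {ofAdd ((1 : ZMod 3), (0 : ℤ)), ofAdd ((2 : ZMod 3), (0 : ℤ)),
   ofAdd ((0 : ZMod 3), (1 : ℤ)), ofAdd ((0 : ZMod 3), (-1 : ℤ))}


/-! ### An abstract colouring lemma -/

/-- A colour different from two given ones. -/
def pick3 (p q : ZMod 3) : ZMod 3 :=
  if p ≠ 0 ∧ q ≠ 0 then 0 else if p ≠ 1 ∧ q ≠ 1 then 1 else 2

theorem pick3_ne : ∀ p q : ZMod 3, pick3 p q ≠ p ∧ pick3 p q ≠ q := by decide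

/-- Staged greedy colouring: at stage `k` recolour the triangles with index `k`. -/
def stage {X : Type*} (τ τ' : X → X) (e : X → ℕ) (t : X → ZMod 3) : ℕ → X → ZMod 3
  | 0 => t
  | k + 1 => fun x => if e x = k then
      t x + pick3 (stage τ τ' e t k (τ x) - t x) (stage τ τ' e t k (τ' x) - t x)
      else stage τ τ' e t k x

theorem stage_measurable {X : Type*} [MeasurableSpace X] (τ τ' : X → X) (e : X → ℕ)
    (t : X → ZMod 3) (hτ : Measurable τ) (hτ' : Measurable τ')
    (he : Measurable e) (ht : @Measurable _ _ _ ⊤ t) (k : ℕ) :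
    @Measurable _ _ _ ⊤ (stage τ τ' e t k) := by
  letI : MeasurableSpace (ZMod 3) := ⊤
  haveI : DiscreteMeasurableSpace (ZMod 3) := ⟨fun _ => trivial⟩
  haveI : Countable (ZMod 3) := inferInstanceAs (Countable (Fin 3))
  induction k with
  | zero => exact ht
  | succ k ih =>
    have h : Measurable (fun x => (t x, stage τ τ' e t k (τ x), stage τ τ' e t k (τ' x))) :=
      ht.prodMk ((ih.comp hτ).prodMk (ih.comp hτ'))
    refine Measurable.ite (he (measurableSet_singleton k)) ?_ ih
    exact (Measurable.of_discrete
      (f := fun p : ZMod 3 × ZMod 3 × ZMod 3 => p.1 + pick3 (p.2.1 - p.1) (p.2.2 - p.1))).comp h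

theorem abstract_coloring {X : Type*} [MeasurableSpace X] (ρ τ τ' : X → X)
    (hρ : Measurable ρ) (hτ : Measurable τ) (hτ' : Measurable τ')
    (ρ3 : ∀ x, ρ (ρ (ρ x)) = x) (h1 : ∀ x, τ (τ' x) = x) (h2 : ∀ x, τ' (τ x) = x)
    (hc : ∀ x, τ (ρ x) = ρ (τ x)) (hc' : ∀ x, τ' (ρ x) = ρ (τ' x))
    (d : X → ℕ) (hd : Measurable d)
    (d1 : ∀ x, d x ≠ d (ρ x)) (d3 : ∀ x, d x ≠ d (τ x))
    (d4 : ∀ x, d x ≠ d (ρ (τ x))) (d5 : ∀ x, d x ≠ d (ρ (ρ (τ x)))) :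
    ∃ c : X → ZMod 3, @Measurable _ _ _ ⊤ c ∧ (∀ x, c (ρ x) = c x + 1) ∧
      ∀ x, c (τ x) ≠ c x := by
  letI : MeasurableSpace (ZMod 3) := ⊤
  haveI : DiscreteMeasurableSpace (ZMod 3) := ⟨fun _ => trivial⟩
  haveI : Countable (ZMod 3) := inferInstanceAs (Countable (Fin 3))
  let e : X → ℕ := fun x => min (d x) (min (d (ρ x)) (d (ρ (ρ x))))
  let t : X → ZMod 3 := fun x => if d x < d (ρ x) ∧ d x < d (ρ (ρ x)) then 0
    else if d (ρ (ρ x)) < d (ρ x) then 1 else 2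
  have hdρ : Measurable (fun x => d (ρ x)) := hd.comp hρ
  have hdρρ : Measurable (fun x => d (ρ (ρ x))) := hd.comp (hρ.comp hρ)
  have he : Measurable e := hd.min (hdρ.min hdρρ)
  have ht : Measurable t := by
    refine Measurable.ite ?_ measurable_const (Measurable.ite ?_ measurable_const measurable_const)
    · exact (measurableSet_lt hd hdρ).inter (measurableSet_lt hd hdρρ)
    · exact measurableSet_lt hdρρ hdρ
  have heρ : ∀ x, e (ρ x) = e x := by
    intro x
    simp only [e, ρ3]
    omega
  have htρ : ∀ x, t (ρ x) = t x + 1 := by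
    intro x
    have a1 := d1 x
    have a2 := d1 (ρ x)
    have a3 := d1 (ρ (ρ x))
    rw [ρ3] at a3
    have e21 : (2 : ZMod 3) + 1 = 0 := by decide
    have e11 : (1 : ZMod 3) + 1 = 2 := by decide
    simp only [t, ρ3]
    split_ifs <;> first | (exfalso; omega) | simp [e21, e11]
  have heτ : ∀ x, e (τ x) ≠ e x := by
    intro x
    have b := fun x => d3 x
    have c1 := d3 x; have c2 := d4 x; have c3 := d5 x
    have c4 := d3 (ρ x); have c5 := d4 (ρ x); have c6 := d5 (ρ x)
    have c7 := d3 (ρ (ρ x)); have c8 := d4 (ρ (ρ x)); have c9 := d5 (ρ (ρ x))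
    simp only [hc, ρ3] at *
    simp only [e]
    omega
  let C := stage τ τ' e t
  have hCs : ∀ k x, C (k+1) x = if e x = k then
      t x + pick3 (C k (τ x) - t x) (C k (τ' x) - t x) else C k x := fun k x => rfl
  have hCm : ∀ k, Measurable (C k) := stage_measurable τ τ' e t hτ hτ' he ht
  have hCρ : ∀ k x, C k (ρ x) = C k x + 1 := by
    intro k
    induction k with
    | zero => exact htρ
    | succ k ih =>
      intro x
      rw [hCs, hCs, heρ, htρ, hc, hc', ih, ih, ih]
      simp only [add_sub_add_right_eq_sub]
      split_ifs
      · ring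
      · rfl
  have hstab : ∀ x k, C (e x + 1 + k) x = C (e x + 1) x := by
    intro x k
    induction k with
    | zero => rfl
    | succ k ih =>
      rw [← add_assoc, hCs, if_neg (by omega), ih]
  have hstab' : ∀ x k, e x < k → C k x = C (e x + 1) x := by
    intro x k hk
    obtain ⟨j, rfl⟩ := Nat.exists_eq_add_of_le (Nat.succ_le_of_lt hk)
    exact hstab x j
  have hne : ∀ x, C (e x + 1) x ≠ C (e x) (τ x) ∧ C (e x + 1) x ≠ C (e x) (τ' x) := by
    intro x
    rw [hCs, if_pos rfl]
    have := pick3_ne (C (e x) (τ x) - t x) (C (e x) (τ' x) - t x)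
    refine ⟨fun h => this.1 ?_, fun h => this.2 ?_⟩
    · exact eq_sub_of_add_eq' h
    · exact eq_sub_of_add_eq' h
  refine ⟨fun x => C (e x + 1) x, ?_, ?_, ?_⟩
  · have : Measurable (fun p : ℕ × X => C (p.1 + 1) p.2) :=
      measurable_from_prod_countable_right (fun k => hCm (k + 1))
    exact this.comp (he.prodMk measurable_id)
  · intro x
    simp only [heρ, hCρ]
  · intro x
    rcases lt_or_gt_of_ne (heτ x) with h | h
    · have := (hne x).1
      rw [hstab' _ _ h] at this
      exact this.symm
    · have := (hne (τ x)).2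
      rw [h2, hstab' _ _ h] at this
      exact this

/-! ### The shift on the free part -/

theorem shiftMap_mul {G : Type*} [Group G] (g h : G) (x : G → Bool) :
    shiftMap g (shiftMap h x) = shiftMap (g * h) x := by
  funext k
  simp [shiftMap, mul_assoc]

theorem shiftMap_one {G : Type*} [Group G] (x : G → Bool) : shiftMap 1 x = x := by
  funext k
  simp [shiftMap]

/-- The shift action restricted to the free part (commutative case). -/
def sh {G : Type*} [CommGroup G] (g : G) (x : FreePart G) : FreePart G :=
  ⟨shiftMap g x, fun h hh heq => x.2 h hh (by
    rw [shiftMap_mul, mul_comm, ← shiftMap_mul] at heq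
    have := congrArg (shiftMap g⁻¹) heq
    simpa [shiftMap_mul, shiftMap_one] using this)⟩

theorem sh_mul {G : Type*} [CommGroup G] (g h : G) (x : FreePart G) :
    sh g (sh h x) = sh (g * h) x := Subtype.ext (shiftMap_mul g h x)

theorem sh_one {G : Type*} [CommGroup G] (x : FreePart G) : sh 1 x = x :=
  Subtype.ext (shiftMap_one x.1)

theorem sh_ne {G : Type*} [CommGroup G] (g : G) (hg : g ≠ 1) (x : FreePart G) : sh g x ≠ x :=
  fun h => x.2 g hg (congrArg Subtype.val h)

theorem sh_measurable {G : Type*} [CommGroup G] (g : G) : Measurable (sh (G := G) g) := by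
  refine Measurable.subtype_mk ?_
  refine measurable_pi_lambda _ fun h => ?_
  exact (measurable_pi_apply (g⁻¹ * h)).comp measurable_subtype_coe

theorem eval_measurable {G : Type*} [CommGroup G] (h : G) :
    Measurable (fun x : FreePart G => x.1 h) :=
  (measurable_pi_apply h).comp measurable_subtype_coe

theorem exists_separating {G : Type*} [CommGroup G] [Countable G] (g : G) (hg : g ≠ 1) :
    ∃ d : FreePart G → ℕ × Bool, Measurable d ∧ ∀ x, d x ≠ d (sh g x) := by
  obtain ⟨f, hf⟩ := exists_surjective_nat G
  have hex : ∀ x : FreePart G, ∃ n, x.1 (f n) ≠ (sh g x).1 (f n) := by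
    intro x
    by_contra hcon
    push Not at hcon
    apply sh_ne g hg x
    apply Subtype.ext
    funext h
    obtain ⟨n, rfl⟩ := hf h
    exact (hcon n).symm
  have hm : Measurable (fun x : FreePart G => Nat.find (hex x)) := by
    refine measurable_find hex fun n => ?_
    exact (measurableSet_eq_fun (eval_measurable (f n))
      ((eval_measurable (f n)).comp (sh_measurable g))).compl
  refine ⟨fun x => (Nat.find (hex x), x.1 (f (Nat.find (hex x)))), ?_, ?_⟩
  · refine hm.prodMk ?_
    have : Measurable (fun p : ℕ × FreePart G => p.2.1 (f p.1)) :=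
      measurable_from_prod_countable_right (fun k => eval_measurable (f k))
    exact this.comp (hm.prodMk measurable_id)
  · intro x hx
    rw [Prod.mk.injEq] at hx
    have := Nat.find_spec (hex x)
    apply this
    rw [hx.2, ← hx.1]

theorem exists_separating_fin {G : Type*} [CommGroup G] [Countable G] {n : ℕ} (g : Fin n → G)
    (hg : ∀ i, g i ≠ 1) :
    ∃ d : FreePart G → ℕ, Measurable d ∧ ∀ i x, d x ≠ d (sh (g i) x) := by
  choose d hd hdx using fun i => exists_separating (g i) (hg i)
  refine ⟨fun x => Encodable.encode (fun i => d i x), ?_, ?_⟩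
  · exact (Measurable.of_discrete (f := fun p : Fin n → ℕ × Bool => Encodable.encode p)).comp
      (measurable_pi_lambda _ hd)
  · intro i x hx
    exact hdx i x (congrFun (Encodable.encode_injective hx) i)

/-- The rotation generator. -/
def gr : Gamma3 := ofAdd ((1 : ZMod 3), (0 : ℤ))

/-- The translation generator. -/
def gt : Gamma3 := ofAdd ((0 : ZMod 3), (1 : ℤ))

theorem gr_ne : gr ≠ 1 := by decide
theorem gr2_ne : gr * gr ≠ 1 := by decide
theorem gr3 : gr * (gr * gr) = 1 := by decide
theorem S3_eq : S3 = {gr, gr * gr, gt, gt⁻¹} := rfl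

theorem hasBorelColoring_three : HasBorelColoring (ShiftAdj S3) 3 := by
  haveI : Countable (ZMod 3) := inferInstanceAs (Countable (Fin 3))
  haveI : Countable Gamma3 := inferInstanceAs (Countable (ZMod 3 × ℤ))
  obtain ⟨d, hd, hdx⟩ := exists_separating_fin ![gr, gt, gr * gt, gr * (gr * gt)] (by decide)
  obtain ⟨c, hcm, hcr, hct⟩ := abstract_coloring (sh gr) (sh gt) (sh gt⁻¹) (sh_measurable _)
    (sh_measurable _) (sh_measurable _)
    (fun x => by rw [sh_mul, sh_mul, mul_assoc, gr3, sh_one])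
    (fun x => by rw [sh_mul, mul_inv_cancel, sh_one])
    (fun x => by rw [sh_mul, inv_mul_cancel, sh_one])
    (fun x => by rw [sh_mul, sh_mul, mul_comm])
    (fun x => by rw [sh_mul, sh_mul, mul_comm])
    d hd (fun x => hdx 0 x) (fun x => hdx 1 x)
    (fun x => by rw [sh_mul]; exact hdx 2 x)
    (fun x => by rw [sh_mul, sh_mul]; exact hdx 3 x)
  refine ⟨c, ?_, ?_⟩
  · exact hcm.mono le_rfl le_top
  · rintro x y ⟨-, s, hs, hy⟩
    have hy : y = sh s x := Subtype.ext hy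
    subst hy
    rw [S3_eq] at hs
    have k1 : ∀ a : ZMod 3, a ≠ a + 1 := by decide
    have k2 : ∀ a : ZMod 3, a ≠ a + 1 + 1 := by decide
    rcases hs with rfl | rfl | rfl | rfl
    · intro h
      exact k1 _ (h.trans (hcr x))
    · rw [← sh_mul]
      intro h
      refine k2 (c x) (h.trans ?_)
      rw [hcr, hcr]
    · exact (hct x).symm
    · have := hct (sh gt⁻¹ x)
      rw [sh_mul, mul_inv_cancel, sh_one] at this
      exact this

theorem freePart_nonempty {G : Type*} [Group G] [DecidableEq G] : Nonempty (FreePart G) := by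
  refine ⟨⟨fun h => decide (h = 1), fun g hg heq => hg ?_⟩⟩
  have := congrFun heq g
  simpa [shiftMap] using this.symm

theorem three_le {n : ℕ} (h : HasBorelColoring (ShiftAdj S3) n) : 3 ≤ n := by
  obtain ⟨c, -, hc⟩ := h
  obtain ⟨x⟩ := freePart_nonempty (G := Gamma3)
  have m1 : gr ∈ S3 := by rw [S3_eq]; simp
  have m2 : gr * gr ∈ S3 := by rw [S3_eq]; simp
  have h1 := hc x (sh gr x) ⟨(sh_ne gr gr_ne x).symm, gr, m1, rfl⟩
  have h2 := hc x (sh (gr * gr) x) ⟨(sh_ne _ gr2_ne x).symm, _, m2, rfl⟩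
  have h3 := hc (sh gr x) (sh (gr * gr) x)
    ⟨by rw [← sh_mul]; exact (sh_ne gr gr_ne _).symm, gr, m1, (shiftMap_mul gr gr x.1).symm⟩
  rw [ne_eq, Fin.ext_iff] at h1 h2 h3
  have := (c x).2
  have := (c (sh gr x)).2
  have := (c (sh (gr * gr) x)).2
  omega

/-- The Borel chromatic number of the shift graph of
`(ℤ/3ℤ × ℤ, {(1,0),(2,0),(0,1),(0,-1)})` equals `3`. -/
theorem borelChromatic_shift_Gamma3 : borelChromatic (ShiftAdj S3) = 3 := by
  refine le_antisymm (Nat.sInf_le hasBorelColoring_three) ?_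
  exact le_csInf ⟨3, hasBorelColoring_three⟩ (fun n hn => three_le hn)
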